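/- arXiv:2411.00363 — 3 statements merged into one kernel-verified Lean document; each statement's English description precedes it below -/
import Mathlib

section
/- (Abstract form of Theorem 2.1: a priori error estimate for the ideal multiscale Galerkin method.) Assume a is in addition symmetric. Let K be a closed subspace of V (the fine-scale space, i.e. the kernel of the interpolation operator) such that ‖ι k‖_H ≤ ε·‖k‖_V for all k ∈ K, for some constant ε > 0. Let W = { v ∈ V : a(v,k) = 0 for all k ∈ K } be the a-orthogonal complement of K (the multiscale space V_h^{ms}). Let u ∈ V satisfy a(u, v) = ⟨f, ι v⟩_H for all v ∈ V, and let u_W ∈ W satisfy a(u_W, w) = ⟨f, ι w⟩_H for all w ∈ W. Then the error lies in the fine-scale space, u − u_W ∈ K, and ‖u − u_W‖_V ≤ (ε/α)·‖f‖_H. -/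
open RealInnerProductSpace

/-- Existence of the Galerkin projection onto a closed subspace for a bounded coercive
bilinear form. -/
theorem exists_galerkin_projection
    {V : Type*} [NormedAddCommGroup V] [InnerProductSpace ℝ V] [CompleteSpace V]
    (a : V →ₗ[ℝ] V →ₗ[ℝ] ℝ) {α β : ℝ} (hα : 0 < α)
    (hbound : ∀ u v : V, |a u v| ≤ β * ‖u‖ * ‖v‖)
    (hcoer : ∀ v : V, α * ‖v‖ ^ 2 ≤ a v v)
    (K : Submodule ℝ V) (hKc : IsClosed (K : Set V)) (e : V) :
    ∃ p ∈ K, ∀ k ∈ K, a (e - p) k = 0 := by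
  have : CompleteSpace K := hKc.completeSpace_coe
  let B : K →L[ℝ] K →L[ℝ] ℝ :=
    LinearMap.mkContinuous₂ (a.domRestrict₁₂ K K) β fun x y => hbound x y
  have hB : IsCoercive B := ⟨α, hα, fun v => by
    rw [mul_assoc, ← sq]
    exact hcoer v⟩
  let l : K →L[ℝ] ℝ :=
    LinearMap.mkContinuous ((a e).domRestrict K) (β * ‖e‖) fun y => hbound e y
  let p : K := hB.continuousLinearEquivOfBilin.symm ((InnerProductSpace.toDual ℝ K).symm l)
  refine ⟨p, p.2, fun k hk => ?_⟩
  have hp : ⟪hB.continuousLinearEquivOfBilin p, (⟨k, hk⟩ : K)⟫ = l ⟨k, hk⟩ := by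
    simp only [p, ContinuousLinearEquiv.apply_symm_apply, InnerProductSpace.toDual_symm_apply]
  rw [hB.continuousLinearEquivOfBilin_apply] at hp
  have hpk : a p k = a e k := hp
  rw [map_sub, LinearMap.sub_apply, hpk, sub_self]

/-- Abstract form of Theorem 2.1: a priori error estimate for the ideal multiscale
Galerkin method. The error `u - u_W` lies in the fine-scale space `K` and
`‖u - u_W‖ ≤ (ε/α) * ‖f‖`, where `‖ι k‖ ≤ ε * ‖k‖` for all `k ∈ K` and
`W = {v | a v k = 0 for all k ∈ K}` is the a-orthogonal complement of `K`. -/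
theorem ideal_multiscale_error
    {V H : Type*} [NormedAddCommGroup V] [InnerProductSpace ℝ V] [CompleteSpace V]
    [NormedAddCommGroup H] [InnerProductSpace ℝ H] [CompleteSpace H]
    (a : V →ₗ[ℝ] V →ₗ[ℝ] ℝ) (α β : ℝ) (hα : 0 < α) (hβ : 0 < β)
    (hbound : ∀ u v : V, |a u v| ≤ β * ‖u‖ * ‖v‖)
    (hcoer : ∀ v : V, α * ‖v‖ ^ 2 ≤ a v v)
    (hsymm : ∀ u v : V, a u v = a v u)
    (ι : V →L[ℝ] H) (Ce : ℝ) (hCe : 0 < Ce) (hι : ∀ v : V, ‖ι v‖ ≤ Ce * ‖v‖)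
    (f : H)
    (K : Submodule ℝ V) (hKc : IsClosed (K : Set V))
    (ε : ℝ) (hε : 0 < ε) (hK : ∀ k ∈ K, ‖ι k‖ ≤ ε * ‖k‖)
    (u : V) (hu : ∀ v : V, a u v = ⟪f, ι v⟫)
    (uW : V) (huWmem : ∀ k ∈ K, a uW k = 0)
    (huW : ∀ w : V, (∀ k ∈ K, a w k = 0) → a uW w = ⟪f, ι w⟫) :
    u - uW ∈ K ∧ ‖u - uW‖ ≤ (ε / α) * ‖f‖ := by
  have hmem : u - uW ∈ K := by
    obtain ⟨p, hpK, hp⟩ := exists_galerkin_projection a hα hbound hcoer K hKc (u - uW)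
    have horth : a (u - uW) (u - uW - p) = 0 := by
      rw [map_sub a, LinearMap.sub_apply, hu, huW _ hp, sub_self]
    have hzero : a (u - uW - p) (u - uW - p) = 0 := by
      rw [map_sub (a (u - uW - p)), hp p hpK, sub_zero, hsymm, horth]
    have hnorm : ‖u - uW - p‖ ^ 2 ≤ 0 :=
      nonpos_of_mul_nonpos_right ((hcoer _).trans_eq hzero) hα
    have hsub : u - uW - p = 0 := by
      rw [← norm_eq_zero]
      exact pow_eq_zero_iff two_ne_zero |>.1 (le_antisymm hnorm (sq_nonneg _))
    rwa [sub_eq_zero.1 hsub]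
  refine ⟨hmem, ?_⟩
  have henergy : a (u - uW) (u - uW) = ⟪f, ι (u - uW)⟫ := by
    rw [map_sub a, LinearMap.sub_apply, hu, huWmem _ hmem, sub_zero]
  have hle : α * ‖u - uW‖ ^ 2 ≤ ‖f‖ * (ε * ‖u - uW‖) :=
    calc α * ‖u - uW‖ ^ 2 ≤ ⟪f, ι (u - uW)⟫ := (hcoer _).trans_eq henergy
      _ ≤ ‖f‖ * ‖ι (u - uW)‖ := real_inner_le_norm _ _
      _ ≤ ‖f‖ * (ε * ‖u - uW‖) := by gcongr; exact hK _ hmem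
  rw [div_mul_eq_mul_div, le_div_iff₀ hα]
  rcases (norm_nonneg (u - uW)).eq_or_lt with h | h
  · rw [← h, zero_mul]
    positivity
  · refine le_of_mul_le_mul_right ?_ h
    linarith
end

section
/- For each index i ∈ {0, …, d}, the barycentric coordinate λ_i is an affine function, so its Fréchet derivative is a constant linear functional ∇λ_i, and its operator norm equals the reciprocal of the distance from the vertex p_i to the affine span of the remaining vertices: ‖∇λ_i‖ = 1 / dist(p_i, affineSpan{p_j : j ≠ i}). (This is the bound ‖∇λ_a‖_{L^∞} ≤ C h⁻¹ on the gradient of the nodal hat function used throughout the proofs of Lemmas 2.1 and 2.2.) -/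
/-- The operator norm of the linear part of a continuous affine functional `f`, times the distance
from `p` to the zero set of `f`, is `|f p|`. -/
theorem ContinuousAffineMap.norm_contLinear_mul_infDist {E : Type*} [NormedAddCommGroup E]
    [NormedSpace ℝ E] (f : E →ᴬ[ℝ] ℝ) (hf : {x | f x = 0}.Nonempty) (p : E) :
    ‖f.contLinear‖ * Metric.infDist p {x | f x = 0} = |f p| := by
  have hsub (x y : E) : f.contLinear (x - y) = f x - f y := by
    simpa using f.toAffineMap.linearMap_vsub x y
  have hle (y : E) (hy : f y = 0) : |f p| ≤ ‖f.contLinear‖ * dist p y := by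
    have h := f.contLinear.le_opNorm (p - y)
    rwa [hsub, hy, sub_zero, Real.norm_eq_abs, ← dist_eq_norm] at h
  apply le_antisymm
  · have hbound : ‖Metric.infDist p {x | f x = 0} • f.contLinear‖ ≤ |f p| := by
      refine ContinuousLinearMap.opNorm_le_bound _ (abs_nonneg _) fun v ↦ ?_
      rw [_root_.smul_apply, norm_smul, Real.norm_of_nonneg Metric.infDist_nonneg]
      by_cases hv : f.contLinear v = 0
      · rw [hv, norm_zero, mul_zero]
        positivity
      · have hy : p - (f p / f.contLinear v) • v ∈ {x | f x = 0} := by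
          have h := hsub p (p - (f p / f.contLinear v) • v)
          rw [sub_sub_cancel, map_smul, smul_eq_mul, div_mul_cancel₀ _ hv] at h
          exact sub_eq_self.1 h.symm
        have h := Metric.infDist_le_dist_of_mem (x := p) hy
        rw [dist_eq_norm, sub_sub_cancel, norm_smul, norm_div, div_mul_eq_mul_div,
          le_div_iff₀ (norm_pos_iff.2 hv)] at h
        exact h
    rwa [norm_smul, Real.norm_of_nonneg Metric.infDist_nonneg, mul_comm] at hbound
  · rcases (norm_nonneg f.contLinear).eq_or_lt with h0 | h0
    · obtain ⟨y, hy⟩ := hf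
      have h := hle y hy
      rw [← h0, zero_mul] at h ⊢
      exact h
    · rw [← div_le_iff₀' h0, Metric.le_infDist hf]
      intro y hy
      rw [div_le_iff₀' h0]
      exact hle y hy

/-- The affine span of all but one of the points of an affine basis is the zero set of the
corresponding barycentric coordinate. -/
theorem AffineBasis.coe_affineSpan_image_ne {ι k V P : Type*} [Finite ι] [Ring k] [Nontrivial k]
    [AddCommGroup V] [Module k V] [AddTorsor V P] (b : AffineBasis ι k P) (i : ι) :
    (affineSpan k (b '' {j | j ≠ i}) : Set P) = {x | b.coord i x = 0} := by
  have := Fintype.ofFinite ι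
  apply Set.Subset.antisymm
  · have hle : affineSpan k (b '' {j | j ≠ i}) ≤
        (AffineSubspace.mk' (0 : k) ⊥).comap (b.coord i) := by
      rw [affineSpan_le]
      rintro _ ⟨j, hj, rfl⟩
      simp [b.coord_apply_ne (Ne.symm hj)]
    intro x hx
    simpa using hle hx
  · intro x hx
    rw [← b.affineCombination_coord_eq_self x]
    refine affineCombination_mem_affineSpan_image (b.sum_coord_apply_eq_one x) ?_ b
    intro j _ hj
    obtain rfl : j = i := by simpa using hj
    exact hx


/-- Each barycentric coordinate `λ_i` has a constant Fréchet derivative `∇λ_i`,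
whose operator norm equals the reciprocal of the distance from the vertex `p_i`
to the affine span of the remaining vertices. -/
theorem norm_grad_barycentric_coord
    (d : ℕ) (b : AffineBasis (Fin (d + 1)) ℝ (EuclideanSpace ℝ (Fin d)))
    (i : Fin (d + 1)) :
    ∃ L : EuclideanSpace ℝ (Fin d) →L[ℝ] ℝ,
      (∀ x : EuclideanSpace ℝ (Fin d), fderiv ℝ (b.coord i) x = L) ∧
      ‖L‖ = 1 / Metric.infDist (b i)
        (affineSpan ℝ (b '' {j | j ≠ i}) : Set (EuclideanSpace ℝ (Fin d))) := by
  let f : EuclideanSpace ℝ (Fin d) →ᴬ[ℝ] ℝ :=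
    ⟨b.coord i, (b.coord i).continuous_of_finiteDimensional⟩
  refine ⟨f.contLinear, fun x ↦ f.fderiv, ?_⟩
  rw [b.coe_affineSpan_image_ne i]
  rcases subsingleton_or_nontrivial (Fin (d + 1)) with hs | hn
  · obtain rfl : d = 0 := by
      have := Fintype.card_le_one_iff_subsingleton.2 hs
      simpa using this
    simp [b.coe_coord_of_subsingleton_eq_one i, Subsingleton.elim f.contLinear 0]
  · obtain ⟨j, hj⟩ := exists_ne i
    have h := f.norm_contLinear_mul_infDist ⟨b j, b.coord_apply_ne hj.symm⟩ (b i)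
    have hone : f (b i) = 1 := b.coord_apply_eq i
    rw [hone, abs_one] at h
    exact eq_one_div_of_mul_eq_one_left h
end

section
/- (Poincaré–Friedrichs inequality with mean value on a convex set, inequality (2.11).) Let K ⊆ ℝ^d be a nonempty bounded convex open set, let v be a real-valued function that is continuously differentiable on an open neighborhood of the closure of K, and let v̄ = (1/vol(K))·∫_K v(x) dx be its mean value over K. Then (∫_K |v(x) − v̄|² dx)^{1/2} ≤ diam(K)·(∫_K ‖∇v(x)‖² dx)^{1/2}, where diam(K) is the diameter of K and vol is Lebesgue measure. -/
open MeasureTheory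

theorem volume_add_volume_le_two_mul_of_midpoint_mem {A B C : Set ℝ}
    (hA : MeasurableSet A) (hB : MeasurableSet B)
    (hAne : A.Nonempty) (hBne : B.Nonempty)
    (h : ∀ x ∈ A, ∀ y ∈ B, (x + y) / 2 ∈ C) :
    volume A + volume B ≤ 2 * volume C := by
  obtain ⟨a₀, ha₀⟩ := hAne
  obtain ⟨b₀, hb₀⟩ := hBne
  have hC : volume ((fun x : ℝ => (2 : ℝ)⁻¹ * x) ⁻¹' C) = 2 * volume C := by
    rw [Real.volume_preimage_mul_left (by norm_num)]
    norm_num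
  rw [← hC]
  have key : ∀ A' ⊆ A, IsCompact A' → ∀ B' ⊆ B, IsCompact B' →
      volume A' + volume B' ≤ volume ((fun x : ℝ => (2 : ℝ)⁻¹ * x) ⁻¹' C) := by
    intro A' hA' hAc B' hB' hBc
    obtain ⟨a, haA, ha⟩ := (hAc.insert a₀).exists_isGreatest (Set.insert_nonempty _ _)
    obtain ⟨b, hbB, hb⟩ := (hBc.insert b₀).exists_isLeast (Set.insert_nonempty _ _)
    have haA' : a ∈ A := Set.insert_subset ha₀ hA' haA
    have hbB' : b ∈ B := Set.insert_subset hb₀ hB' hbB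
    have e1 : volume A' = volume ((fun x => x + -b) ⁻¹' A') := by
      rw [measure_preimage_add_right]
    have e2 : volume B' = volume ((fun x => x + -a) ⁻¹' B') := by
      rw [measure_preimage_add_right]
    have hd : AEDisjoint volume ((fun x => x + -b) ⁻¹' A') ((fun x => x + -a) ⁻¹' B') := by
      refine measure_mono_null (t := {a + b}) ?_ (by simp)
      rintro x ⟨h1, h2⟩
      have h1' := ha (Set.mem_insert_of_mem _ h1)
      have h2' := hb (Set.mem_insert_of_mem _ h2)
      simp only [Set.mem_singleton_iff]
      linarith
    rw [e1, e2, ← measure_union₀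
      ((hBc.measurableSet.preimage (measurable_add_const _)).nullMeasurableSet) hd]
    refine measure_mono (Set.union_subset ?_ ?_)
    · intro x hx
      have := h _ (hA' hx) b hbB'
      simp only [Set.mem_preimage]
      convert this using 1; ring
    · intro x hx
      have := h a haA' _ (hB' hx)
      simp only [Set.mem_preimage]
      convert this using 1; ring
  have sup : ∀ X : Set ℝ, MeasurableSet X →
      volume X = ⨆ S : {S : Set ℝ // S ⊆ X ∧ IsCompact S}, volume S.1 := by
    intro X hX
    rw [hX.measure_eq_iSup_isCompact, iSup_subtype]
    simp only [iSup_and]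
  have : ∀ X : Set ℝ, Nonempty {S : Set ℝ // S ⊆ X ∧ IsCompact S} := fun X =>
    ⟨∅, Set.empty_subset _, isCompact_empty⟩
  rw [sup A hA, sup B hB]
  simp only [ENNReal.iSup_add, ENNReal.add_iSup]
  exact iSup_le fun S => iSup_le fun T => key _ (by grind) (by grind) _ (by grind) (by grind)

theorem lintegral_add_lintegral_le_of_normalized {f g h : ℝ → ℝ}
    (hf : Measurable f) (hg : Measurable g) (hh : Measurable h)
    (f0 : ∀ x, 0 ≤ f x) (g0 : ∀ x, 0 ≤ g x) (h0 : ∀ x, 0 ≤ h x)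
    (f1 : ∀ x, f x ≤ 1) (g1 : ∀ x, g x ≤ 1)
    (fs : ∀ t < 1, ∃ x, t < f x) (gs : ∀ t < 1, ∃ x, t < g x)
    (H : ∀ t x y, 0 < t → t < f x → t < g y → t < h ((x + y) / 2)) :
    (∫⁻ x, ENNReal.ofReal (f x)) + ∫⁻ x, ENNReal.ofReal (g x) ≤
      2 * ∫⁻ x, ENNReal.ofReal (h x) := by
  rw [lintegral_eq_lintegral_meas_lt _ (ae_of_all _ f0) hf.aemeasurable,
    lintegral_eq_lintegral_meas_lt _ (ae_of_all _ g0) hg.aemeasurable,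
    lintegral_eq_lintegral_meas_lt _ (ae_of_all _ h0) hh.aemeasurable,
    ← lintegral_const_mul' _ _ (by norm_num), ← lintegral_add_left']
  · refine setLIntegral_mono_ae' measurableSet_Ioi (ae_of_all _ fun t ht => ?_)
    rcases lt_or_ge t 1 with h1 | h1
    · exact volume_add_volume_le_two_mul_of_midpoint_mem (measurableSet_lt measurable_const hf)
        (measurableSet_lt measurable_const hg) (fs t h1) (gs t h1)
        fun x hx y hy => H t x y ht hx hy
    · have e1 : {a | t < f a} = ∅ := by
        ext x; simpa using (f1 x).trans h1
      have e2 : {a | t < g a} = ∅ := by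
        ext x; simpa using (g1 x).trans h1
      simp [e1, e2]
  · have : Antitone fun t : ℝ => volume {a | t < f a} := fun s t hst =>
      measure_mono fun x hx => lt_of_le_of_lt hst hx
    exact this.measurable.aemeasurable

open ENNReal in
theorem four_mul_le_add_sq (a b : ℝ≥0∞) : 4 * (a * b) ≤ (a + b) ^ 2 := by
  rcases eq_or_ne a ⊤ with rfl | ha
  · simp
  rcases eq_or_ne b ⊤ with rfl | hb
  · simp
  lift a to NNReal using ha
  lift b to NNReal using hb
  norm_cast
  rw [← NNReal.coe_le_coe]
  push_cast
  nlinarith [sq_nonneg ((a : ℝ) - b)]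

open ENNReal in
theorem prekopaLeindler_real_of_bounded {f g h : ℝ → ℝ≥0∞}
    (hf : Measurable f) (hg : Measurable g) (hh : Measurable h)
    (hfb : ⨆ x, f x ≠ ⊤) (hgb : ⨆ x, g x ≠ ⊤)
    (H : ∀ x y, f x * g y ≤ h ((x + y) / 2) ^ 2) :
    (∫⁻ x, f x) * ∫⁻ x, g x ≤ (∫⁻ x, h x) ^ 2 := by
  set M := ⨆ x, f x with hM
  set N := ⨆ x, g x with hN
  rcases eq_or_ne M 0 with hM0 | hM0
  · have : ∀ x, f x = 0 := by simpa [hM] using hM0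
    simp [this]
  rcases eq_or_ne N 0 with hN0 | hN0
  · have : ∀ x, g x = 0 := by simpa [hN] using hN0
    simp [this]
  have hfM : ∀ x, f x ≤ M := le_iSup f
  have hgN : ∀ x, g x ≤ N := le_iSup g
  set s : ℝ≥0∞ := (M * N) ^ (1 / 2 : ℝ) with hs
  have hMN0 : M * N ≠ 0 := mul_ne_zero hM0 hN0
  have hMNt : M * N ≠ ⊤ := ENNReal.mul_ne_top hfb hgb
  have hs2 : s ^ 2 = M * N := by
    rw [hs, ← ENNReal.rpow_natCast, ← ENNReal.rpow_mul]; norm_num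
  have hs0 : s ≠ 0 := by rintro h0; rw [h0] at hs2; exact hMN0 (by simpa using hs2.symm)
  have hst : s ≠ ⊤ := by rintro h0; rw [h0] at hs2; exact hMNt (by simpa using hs2.symm)
  have norm_le : ∀ (f : ℝ → ℝ≥0∞) (M : ℝ≥0∞), M ≠ 0 → M ≠ ⊤ → (∀ x, f x ≤ M) →
      ∀ x, f x / M ≤ 1 := fun f M h0 ht hle x =>
    ENNReal.div_le_of_le_mul (by simpa using hle x)
  have lt_iff : ∀ (t : ℝ) (a : ℝ≥0∞), 0 < t → a ≠ ⊤ → (t < a.toReal ↔ ENNReal.ofReal t < a) :=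
    fun t a ht ha => by rw [ENNReal.ofReal_lt_iff_lt_toReal ht.le ha]
  have ofReal_int : ∀ (f : ℝ → ℝ≥0∞) (M : ℝ≥0∞), M ≠ 0 → M ≠ ⊤ → (∀ x, f x ≤ M) →
      ∫⁻ x, ENNReal.ofReal (f x / M).toReal = (∫⁻ x, f x) / M := by
    intro f M h0 ht hle
    simp_rw [fun x => ENNReal.ofReal_toReal
      ((norm_le f M h0 ht hle x).trans_lt one_lt_top).ne, div_eq_mul_inv]
    exact lintegral_mul_const' _ _ (ENNReal.inv_ne_top.2 h0)
  have sup_lt : ∀ (f : ℝ → ℝ≥0∞) (M : ℝ≥0∞), M ≠ 0 → M ≠ ⊤ → M = ⨆ x, f x →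
      ∀ t < (1 : ℝ), ∃ x, t < (f x / M).toReal := by
    intro f M h0 ht hMe t htl
    have hle : ∀ x, f x ≤ M := fun x => hMe ▸ le_iSup f x
    have : ENNReal.ofReal (max t 0) * M < ⨆ x, f x := by
      rw [← hMe]
      calc ENNReal.ofReal (max t 0) * M < 1 * M :=
            ENNReal.mul_lt_mul_left h0 ht (by rw [ENNReal.ofReal_lt_one]; simp [htl])
        _ = M := one_mul M
    obtain ⟨x, hx⟩ := lt_iSup_iff.1 this
    refine ⟨x, (le_max_left t 0).trans_lt ?_⟩
    rw [← ENNReal.ofReal_lt_iff_lt_toReal (le_max_right _ _)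
      ((norm_le f M h0 ht hle x).trans_lt one_lt_top).ne]
    rwa [ENNReal.lt_div_iff_mul_lt (Or.inl h0) (Or.inl ht)]
  have key := lintegral_add_lintegral_le_of_normalized
    (f := fun x => (f x / M).toReal) (g := fun x => (g x / N).toReal)
    (h := fun x => (min (h x / s) 1).toReal)
    (hf.div_const _).ennreal_toReal (hg.div_const _).ennreal_toReal
    ((hh.div_const _).min measurable_const).ennreal_toReal
    (fun _ => toReal_nonneg) (fun _ => toReal_nonneg) (fun _ => toReal_nonneg)
    (fun x => toReal_le_of_le_ofReal zero_le_one (by simpa using norm_le f M hM0 hfb hfM x))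
    (fun x => toReal_le_of_le_ofReal zero_le_one (by simpa using norm_le g N hN0 hgb hgN x))
    (sup_lt f M hM0 hfb hM) (sup_lt g N hN0 hgb hN) ?_
  · rw [ofReal_int f M hM0 hfb hfM, ofReal_int g N hN0 hgb hgN] at key
    have hle : ∫⁻ x, ENNReal.ofReal (min (h x / s) 1).toReal ≤ (∫⁻ x, h x) / s := by
      rw [div_eq_mul_inv, ← lintegral_mul_const' _ _ (ENNReal.inv_ne_top.2 hs0)]
      refine lintegral_mono fun x => ofReal_toReal_le.trans ?_
      rw [← div_eq_mul_inv]; exact min_le_left _ _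
    have h2 : 4 * ((∫⁻ x, f x) / M * ((∫⁻ x, g x) / N)) ≤ 4 * ((∫⁻ x, h x) / s) ^ 2 :=
      calc _ ≤ ((∫⁻ x, f x) / M + (∫⁻ x, g x) / N) ^ 2 := four_mul_le_add_sq _ _
        _ ≤ (2 * ((∫⁻ x, h x) / s)) ^ 2 := by gcongr; exact key.trans (by gcongr)
        _ = _ := by ring
    rw [ENNReal.mul_le_mul_iff_right (by norm_num) (by norm_num)] at h2
    have h3 : (∫⁻ x, f x) / M * ((∫⁻ x, g x) / N) = (∫⁻ x, f x) * (∫⁻ x, g x) / (M * N) := by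
      simp only [div_eq_mul_inv]
      rw [ENNReal.mul_inv (Or.inl hM0) (Or.inl hfb)]; ring
    have h4 : ((∫⁻ x, h x) / s) ^ 2 = (∫⁻ x, h x) ^ 2 / (M * N) := by
      rw [div_eq_mul_inv, mul_pow, ← ENNReal.inv_pow, hs2, ← div_eq_mul_inv]
    rw [h3, h4] at h2
    simpa [ENNReal.div_le_iff hMN0 hMNt, ENNReal.div_mul_cancel hMN0 hMNt] using h2
  · intro t x y ht hx hy
    have hx1 := norm_le f M hM0 hfb hfM x
    have hy1 := norm_le g N hN0 hgb hgN y
    have t1 : t < 1 := hx.trans_le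
      (toReal_le_of_le_ofReal zero_le_one (by simpa using hx1))
    rw [lt_iff t _ ht (hx1.trans_lt one_lt_top).ne,
      ENNReal.lt_div_iff_mul_lt (Or.inl hM0) (Or.inl hfb)] at hx
    rw [lt_iff t _ ht (hy1.trans_lt one_lt_top).ne,
      ENNReal.lt_div_iff_mul_lt (Or.inl hN0) (Or.inl hgb)] at hy
    rw [lt_iff t _ ht ((min_le_right _ _).trans_lt one_lt_top).ne, lt_min_iff]
    refine ⟨?_, by rwa [ENNReal.ofReal_lt_one]⟩
    rw [ENNReal.lt_div_iff_mul_lt (Or.inl hs0) (Or.inl hst)]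
    refine lt_of_not_ge fun hle => (pow_le_pow_left' hle 2).not_gt ?_
    calc (ENNReal.ofReal t * s) ^ 2 = (ENNReal.ofReal t * M) * (ENNReal.ofReal t * N) := by
          rw [mul_pow, hs2]; ring
      _ < f x * g y := ENNReal.mul_lt_mul hx hy
      _ ≤ _ := H x y

open ENNReal in
theorem prekopaLeindler_real {f g h : ℝ → ℝ≥0∞}
    (hf : Measurable f) (hg : Measurable g) (hh : Measurable h)
    (H : ∀ x y, f x * g y ≤ h ((x + y) / 2) ^ 2) :
    (∫⁻ x, f x) * ∫⁻ x, g x ≤ (∫⁻ x, h x) ^ 2 := by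
  have trunc : ∀ f : ℝ → ℝ≥0∞, Measurable f →
      ∫⁻ x, f x = ⨆ n : ℕ, ∫⁻ x, min (f x) n := by
    intro f hf
    rw [← lintegral_iSup (fun n => hf.min measurable_const)]
    · congr with x
      rw [← inf_iSup_eq, ENNReal.iSup_natCast, inf_top_eq]
    · intro m n hmn x
      exact min_le_min le_rfl (by exact_mod_cast hmn)
  have bdd : ∀ (f : ℝ → ℝ≥0∞) (n : ℕ), ⨆ x, min (f x) n ≠ ⊤ := fun f n =>
    ((iSup_le fun x => min_le_right _ _).trans_lt (ENNReal.natCast_lt_top n)).ne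
  rw [trunc f hf, trunc g hg]
  simp only [ENNReal.iSup_mul, ENNReal.mul_iSup]
  refine iSup_le fun m => iSup_le fun n => ?_
  exact prekopaLeindler_real_of_bounded (hf.min measurable_const) (hg.min measurable_const) hh
    (bdd f _) (bdd g _) fun x y =>
      (mul_le_mul' (min_le_left _ _) (min_le_left _ _)).trans (H x y)

open ENNReal in
theorem prekopaLeindler_pi (n : ℕ) {f g h : (Fin n → ℝ) → ℝ≥0∞}
    (hf : Measurable f) (hg : Measurable g) (hh : Measurable h)
    (H : ∀ x y, f x * g y ≤ h ((2 : ℝ)⁻¹ • (x + y)) ^ 2) :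
    (∫⁻ x, f x) * ∫⁻ x, g x ≤ (∫⁻ x, h x) ^ 2 := by
  induction n with
  | zero =>
    have e : ∀ F : (Fin 0 → ℝ) → ℝ≥0∞, ∫⁻ x, F x = F 0 := by
      intro F
      rw [lintegral_unique]
      simp only [volume_pi, Measure.pi_univ, Finset.univ_eq_empty, Finset.prod_empty, mul_one]
      exact congrArg F (Subsingleton.elim _ _)
    rw [e, e, e]
    simpa using H 0 0
  | succ n ih =>
    have mp := (volume_preserving_piFinSuccAbove (fun _ : Fin (n + 1) => ℝ) 0).symm
    set T := (MeasurableEquiv.piFinSuccAbove (fun _ : Fin (n + 1) => ℝ) 0).symm with hT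
    have split : ∀ F : (Fin (n + 1) → ℝ) → ℝ≥0∞, Measurable F →
        ∫⁻ x, F x = ∫⁻ s : ℝ, ∫⁻ y : Fin n → ℝ, F (T (s, y)) := by
      intro F hF
      rw [← mp.lintegral_comp hF]
      exact lintegral_prod _ (hF.comp T.measurable).aemeasurable
    rw [split f hf, split g hg, split h hh]
    have hm : ∀ F : (Fin (n + 1) → ℝ) → ℝ≥0∞, Measurable F →
        Measurable fun s : ℝ => ∫⁻ y : Fin n → ℝ, F (T (s, y)) := fun F hF =>
      (hF.comp T.measurable).lintegral_prod_right'
    have hsec : ∀ F : (Fin (n + 1) → ℝ) → ℝ≥0∞, Measurable F → ∀ s : ℝ,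
        Measurable fun y : Fin n → ℝ => F (T (s, y)) := fun F hF s =>
      (hF.comp T.measurable).comp measurable_prodMk_left
    refine prekopaLeindler_real (hm f hf) (hm g hg) (hm h hh) fun s t => ?_
    refine ih (hsec f hf s) (hsec g hg t) (hsec h hh _) fun x y => ?_
    refine (H _ _).trans_eq ?_
    congr 2
    ext i
    refine Fin.cases ?_ (fun j => ?_) i
    · simp [hT, MeasurableEquiv.piFinSuccAbove]; ring
    · simp [hT, MeasurableEquiv.piFinSuccAbove]; ring

open ENNReal in
theorem prekopaLeindler {d : ℕ} {f g h : EuclideanSpace ℝ (Fin d) → ℝ≥0∞}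
    (hf : Measurable f) (hg : Measurable g) (hh : Measurable h)
    (H : ∀ x y, f x * g y ≤ h ((2 : ℝ)⁻¹ • (x + y)) ^ 2) :
    (∫⁻ x, f x) * ∫⁻ x, g x ≤ (∫⁻ x, h x) ^ 2 := by
  have mp := PiLp.volume_preserving_toLp (Fin d)
  rw [← mp.lintegral_comp hf, ← mp.lintegral_comp hg, ← mp.lintegral_comp hh]
  refine prekopaLeindler_pi d (hf.comp mp.measurable) (hg.comp mp.measurable)
    (hh.comp mp.measurable) fun x y => ?_
  exact H _ _

theorem exp_ge_second_order {B v w ε : ℝ} (hv : |v| ≤ B) (hw : |w| ≤ B)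
    (h0 : 0 < ε) (h1 : ε ≤ 1) (h2 : 2 * B * ε ≤ 1) :
    1 + ε * v - ε ^ 2 * w + ε ^ 2 * v ^ 2 / 2 - ε ^ 3 * (B ^ 2 + 8 * B ^ 3) ≤
      Real.exp (ε * v - ε ^ 2 * w) := by
  have hB : 0 ≤ B := (abs_nonneg v).trans hv
  set s := ε * v - ε ^ 2 * w with hs
  have hsB : |s| ≤ 2 * B * ε := by
    have a1 : |ε * v| ≤ ε * B := by rw [abs_mul, abs_of_pos h0]; gcongr
    have a2 : |ε ^ 2 * w| ≤ ε * B := by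
      rw [abs_mul, abs_of_pos (by positivity)]
      gcongr
      nlinarith
    linarith [abs_sub (ε * v) (ε ^ 2 * w)]
  have hb := Real.exp_bound (hsB.trans h2) (n := 3) (by norm_num)
  have h3 : |s| ^ 3 ≤ (2 * B * ε) ^ 3 := pow_le_pow_left₀ (abs_nonneg _) hsB 3
  have h4 : |s| ^ 3 * ((Nat.succ 3 : ℕ) / ((Nat.factorial 3 : ℕ) * (3 : ℕ)) : ℝ) ≤ |s| ^ 3 := by
    refine mul_le_of_le_one_right (by positivity) ?_
    norm_num [Nat.factorial]
  have h5 := (abs_le.1 (hb.trans h4)).1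
  simp only [Finset.sum_range_succ, Finset.sum_range_zero, Nat.factorial] at h5
  norm_num at h5
  have hvw : v * w ≤ B ^ 2 := by
    calc v * w ≤ |v * w| := le_abs_self _
      _ = |v| * |w| := abs_mul _ _
      _ ≤ B * B := by gcongr
      _ = B ^ 2 := by ring
  have hsq : ε ^ 2 * v ^ 2 - 2 * ε ^ 3 * B ^ 2 ≤ s ^ 2 := by
    have : ε ^ 3 * (v * w) ≤ ε ^ 3 * B ^ 2 := by gcongr
    nlinarith [sq_nonneg (ε ^ 2 * w)]
  have hc : (2 * B * ε) ^ 3 = 8 * ε ^ 3 * B ^ 3 := by ring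
  rw [hc] at h3
  nlinarith

open Filter Topology in
theorem integral_sq_le_of_integral_exp_mul_le {α : Type*} [MeasurableSpace α] {μ : Measure α}
    [IsFiniteMeasure μ] {v w : α → ℝ} {B : ℝ} (hv : Measurable v) (hw : Measurable w)
    (hvB : ∀ x, |v x| ≤ B) (hwB : ∀ x, |w x| ≤ B) (hv0 : ∫ x, v x ∂μ = 0)
    (H : ∀ᶠ ε in 𝓝[>] (0 : ℝ), (∫ x, Real.exp (ε * v x - ε ^ 2 * w x) ∂μ) *
      (∫ x, Real.exp (-(ε * v x)) ∂μ) ≤ μ.real Set.univ ^ 2) :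
    ∫ x, v x ^ 2 ∂μ ≤ ∫ x, w x ∂μ := by
  rcases eq_or_ne μ 0 with rfl | hμ
  · simp
  have hZ : 0 < μ.real Set.univ := by
    have : NeZero μ := ⟨hμ⟩
    exact measureReal_univ_pos
  obtain ⟨x₀⟩ : Nonempty α := by
    by_contra hne
    rw [not_nonempty_iff] at hne
    exact hμ (Measure.eq_zero_of_isEmpty μ)
  have hB : 0 ≤ B := (abs_nonneg _).trans (hvB x₀)
  set Z := μ.real Set.univ with hZdef
  set A := ∫ x, v x ^ 2 ∂μ
  set W := ∫ x, w x ∂μ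
  set C := Z * (B ^ 2 + 8 * B ^ 3) with hC
  have bdd_int : ∀ {f : α → ℝ} {M : ℝ}, Measurable f → (∀ x, |f x| ≤ M) → Integrable f μ :=
    fun hf hM => Integrable.of_bound hf.aestronglyMeasurable _ (ae_of_all _ hM)
  have expand : ∀ (v w : α → ℝ), Measurable v → Measurable w → (∀ x, |v x| ≤ B) →
      (∀ x, |w x| ≤ B) → ∀ ε : ℝ, 0 < ε → ε ≤ 1 → 2 * B * ε ≤ 1 →
      Z + ε * (∫ x, v x ∂μ) - ε ^ 2 * (∫ x, w x ∂μ) + ε ^ 2 / 2 * (∫ x, v x ^ 2 ∂μ) - ε ^ 3 * C ≤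
      ∫ x, Real.exp (ε * v x - ε ^ 2 * w x) ∂μ := by
    intro v w hv hw hvB hwB ε h0 h1 h2
    have vi := bdd_int hv hvB
    have wi := bdd_int hw hwB
    have v2i : Integrable (fun x => v x ^ 2) μ :=
      bdd_int (hv.pow_const 2) (M := B ^ 2) fun x => by
        rw [abs_pow]; exact pow_le_pow_left₀ (abs_nonneg _) (hvB x) 2
    have e : ∫ x, (1 + ε * v x - ε ^ 2 * w x + ε ^ 2 / 2 * v x ^ 2 -
        ε ^ 3 * (B ^ 2 + 8 * B ^ 3)) ∂μ = Z + ε * (∫ x, v x ∂μ) - ε ^ 2 * (∫ x, w x ∂μ) +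
          ε ^ 2 / 2 * (∫ x, v x ^ 2 ∂μ) - ε ^ 3 * C := by
      rw [integral_sub (by fun_prop) (by fun_prop), integral_add (by fun_prop) (by fun_prop),
        integral_sub (by fun_prop) (by fun_prop), integral_add (by fun_prop) (by fun_prop)]
      simp only [integral_const_mul, integral_const, smul_eq_mul, hC, ← hZdef]
      ring
    rw [← e]
    refine integral_mono (by fun_prop) ?_ fun x => ?_
    · refine bdd_int (M := Real.exp 1) (by fun_prop) fun x => ?_
      rw [abs_of_pos (Real.exp_pos _), Real.exp_le_exp]
      have a1 : ε * v x ≤ ε * B := by gcongr; exact (abs_le.1 (hvB x)).2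
      have a2 : ε ^ 2 * (-w x) ≤ ε * B := by
        have : ε ^ 2 * (-w x) ≤ ε ^ 2 * B := by gcongr; linarith [(abs_le.1 (hwB x)).1]
        nlinarith [mul_nonneg h0.le hB]
      linarith
    · have := exp_ge_second_order (hvB x) (hwB x) h0 h1 h2
      simp only
      linarith
  have lim : Tendsto (fun ε : ℝ => Z * (A - W - 2 * (ε * C)) +
      ε ^ 2 * ((A / 2 - W - ε * C) * (A / 2 - ε * C))) (𝓝[>] 0) (𝓝 (Z * (A - W))) := by
    refine tendsto_nhdsWithin_of_tendsto_nhds ?_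
    have : Continuous (fun ε : ℝ => Z * (A - W - 2 * (ε * C)) +
      ε ^ 2 * ((A / 2 - W - ε * C) * (A / 2 - ε * C))) := by fun_prop
    convert this.tendsto 0 using 2
    ring
  have posev : ∀ a : ℝ, ∀ᶠ ε in 𝓝[>] (0 : ℝ), 0 < Z + ε ^ 2 * (a - ε * C) := by
    intro a
    refine nhdsWithin_le_nhds ?_
    have : Continuous fun ε : ℝ => Z + ε ^ 2 * (a - ε * C) := by fun_prop
    refine this.continuousAt.eventually (lt_mem_nhds ?_)
    simpa using hZ
  have small : ∀ᶠ ε in 𝓝[>] (0 : ℝ), 2 * B * ε < 1 := by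
    refine nhdsWithin_le_nhds ?_
    have : Continuous fun ε : ℝ => 2 * B * ε := by fun_prop
    refine this.continuousAt.eventually (gt_mem_nhds ?_)
    simp
  have hle : Z * (A - W) ≤ 0 := by
    refine le_of_tendsto lim ?_
    filter_upwards [H, posev (A / 2 - W), posev (A / 2), small,
      Ioo_mem_nhdsGT (zero_lt_one (α := ℝ))] with ε hε p1 p2 hs hI
    have b1 := expand v w hv hw hvB hwB ε hI.1 hI.2.le hs.le
    have b2 := expand (fun x => -v x) (fun _ => 0) hv.neg measurable_const
      (by simpa using hvB) (by simpa using fun _ => hB) ε hI.1 hI.2.le hs.le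
    simp only [integral_neg, hv0, neg_sq, mul_zero, sub_zero, integral_zero, mul_neg, neg_zero]
      at b1 b2
    have hm : (Z + ε ^ 2 * (A / 2 - W - ε * C)) * (Z + ε ^ 2 * (A / 2 - ε * C)) ≤ Z ^ 2 := by
      refine le_trans (mul_le_mul ?_ ?_ p2.le ?_) hε
      · linarith
      · linarith
      · exact integral_nonneg fun x => (Real.exp_pos _).le
    have h2 : 0 < ε ^ 2 := pow_pos hI.1 2
    refine nonpos_of_mul_nonpos_right (a := ε ^ 2) ?_ h2
    nlinarith
  nlinarith

open Filter Topology in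
theorem eventually_mul_sub_le_of_uniformContinuousOn_fderiv
    {E : Type*} [NormedAddCommGroup E] [NormedSpace ℝ E] {K : Set E} (hK : Convex ℝ K)
    {v : E → ℝ} (hd : ∀ x ∈ K, DifferentiableAt ℝ v x)
    (hu : UniformContinuousOn (fderiv ℝ v) K) {B M : ℝ} (hB : ∀ x ∈ K, |v x| ≤ B)
    (hM : ∀ x ∈ K, ‖fderiv ℝ v x‖ ≤ M) {c δ : ℝ} (hc : 0 < c) (hδ : 0 < δ) :
    ∀ᶠ ε in 𝓝[>] (0 : ℝ), ∀ x ∈ K, ∀ y ∈ K,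
      ε * (v x - v y) ≤ c / 4 * ‖x - y‖ ^ 2 + ε ^ 2 * (‖fderiv ℝ v x‖ ^ 2 / c + δ) := by
  have hωex : ∃ ω > 0, 2 * ω * M + ω ^ 2 < c * δ := by
    have : Continuous fun ω : ℝ => 2 * ω * M + ω ^ 2 := by fun_prop
    have h1 : ∀ᶠ ω in 𝓝[>] (0 : ℝ), 2 * ω * M + ω ^ 2 < c * δ := by
      refine nhdsWithin_le_nhds (this.continuousAt.eventually (gt_mem_nhds ?_))
      simpa using mul_pos hc hδ
    obtain ⟨ω, h, h'⟩ := (h1.and self_mem_nhdsWithin).exists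
    exact ⟨ω, h', h⟩
  obtain ⟨ω, hω, hωδ⟩ := hωex
  obtain ⟨η, hη, hηω⟩ := Metric.uniformContinuousOn_iff.1 hu ω hω
  have small : ∀ᶠ ε in 𝓝[>] (0 : ℝ), ε * (2 * B) < c / 4 * η ^ 2 := by
    have : Continuous fun ε : ℝ => ε * (2 * B) := by fun_prop
    refine nhdsWithin_le_nhds (this.continuousAt.eventually (gt_mem_nhds ?_))
    simp only [zero_mul]; positivity
  filter_upwards [small, self_mem_nhdsWithin] with ε hε (hε0 : 0 < ε) x hx y hy
  set G := ‖fderiv ℝ v x‖ with hG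
  have hG0 : 0 ≤ G := norm_nonneg _
  rcases lt_or_ge ‖x - y‖ η with hxy | hxy
  · have hl : ‖v x - v y‖ ≤ (G + ω) * ‖x - y‖ := by
      refine ((hK.inter (convex_ball x η)).norm_image_sub_le_of_norm_fderiv_le
        (fun z hz => hd z hz.1) (fun z hz => ?_)) ⟨hy, ?_⟩ ⟨hx, Metric.mem_ball_self hη⟩
      · have h1 := hηω z hz.1 x hx hz.2
        rw [dist_eq_norm] at h1
        linarith [norm_sub_norm_le (fderiv ℝ v z) (fderiv ℝ v x)]
      · rwa [Metric.mem_ball, dist_comm, dist_eq_norm]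
    have hl' : ε * (v x - v y) ≤ ε * ((G + ω) * ‖x - y‖) := by
      gcongr; exact (le_abs_self _).trans hl
    have amgm : ε * ((G + ω) * ‖x - y‖) ≤ c / 4 * ‖x - y‖ ^ 2 + ε ^ 2 * ((G + ω) ^ 2 / c) := by
      have : c / 4 * ‖x - y‖ ^ 2 + ε ^ 2 * ((G + ω) ^ 2 / c) - ε * ((G + ω) * ‖x - y‖) =
          (c / 2 * ‖x - y‖ - ε * (G + ω)) ^ 2 / c := by field_simp; ring
      have h0 : 0 ≤ (c / 2 * ‖x - y‖ - ε * (G + ω)) ^ 2 / c := by positivity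
      linarith
    have hsq : (G + ω) ^ 2 / c ≤ G ^ 2 / c + δ := by
      rw [div_add' _ _ _ hc.ne']
      gcongr
      nlinarith [hM x hx]
    have := mul_le_mul_of_nonneg_left hsq (sq_nonneg ε)
    linarith
  · have h1 : v x - v y ≤ 2 * B := by
      linarith [(abs_le.1 (hB x hx)).2, (abs_le.1 (hB y hy)).1]
    have h2 : ε * (v x - v y) ≤ ε * (2 * B) := by gcongr
    have h3 : c / 4 * η ^ 2 ≤ c / 4 * ‖x - y‖ ^ 2 := by gcongr
    have h4 : 0 ≤ ε ^ 2 * (G ^ 2 / c + δ) := by positivity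
    linarith

theorem exists_norm_sub_sq_le_diam_sq {E : Type*} [NormedAddCommGroup E] [InnerProductSpace ℝ E]
    {K : Set E} (hne : K.Nonempty) (hb : Bornology.IsBounded K) (hD : 0 < Metric.diam K) :
    ∃ c : E, ∀ x ∈ K, ‖x - c‖ ^ 2 ≤ 18 / 25 * Metric.diam K ^ 2 := by
  set D := Metric.diam K with hDdef
  have hdist : ∀ x ∈ K, ∀ y ∈ K, ‖x - y‖ ≤ D := fun x hx y hy => by
    rw [← dist_eq_norm]; exact Metric.dist_le_diam_of_mem hb hx hy
  by_contra! hcon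
  set S : Set ℝ := {q | ∃ c : E, ∀ x ∈ K, ‖x - c‖ ^ 2 ≤ q} with hS
  have hSlow : ∀ q ∈ S, 18 / 25 * D ^ 2 < q := by
    rintro q ⟨c, hc⟩
    obtain ⟨x, hx, hlt⟩ := hcon c
    exact hlt.trans_le (hc x hx)
  obtain ⟨p, hp⟩ := hne
  have hSne : S.Nonempty := ⟨D ^ 2, p, fun x hx =>
    pow_le_pow_left₀ (norm_nonneg _) (hdist x hx p hp) 2⟩
  have hSb : BddBelow S := ⟨_, fun q hq => (hSlow q hq).le⟩
  have hI : 18 / 25 * D ^ 2 ≤ sInf S := le_csInf hSne fun q hq => (hSlow q hq).le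
  have hIpos : 0 < sInf S := lt_of_lt_of_le (by positivity) hI
  obtain ⟨q, hqS, hq⟩ := exists_lt_of_csInf_lt hSne
    (show sInf S < 100 / 99 * sInf S by linarith)
  have hq1 : 99 / 100 * q ∉ S := fun h => by linarith [csInf_le hSb h]
  obtain ⟨c, hc⟩ := hqS
  have : ∃ p ∈ K, 99 / 100 * q < ‖p - c‖ ^ 2 := by
    by_contra! h
    exact hq1 ⟨c, h⟩
  obtain ⟨p, hp, hpq⟩ := this
  have hmid : 1 / 2 * q + 1 / 2 * D ^ 2 - 1 / 4 * (99 / 100 * q) ∈ S := by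
    refine ⟨midpoint ℝ c p, fun x hx => ?_⟩
    have e1 : x - midpoint ℝ c p = (2 : ℝ)⁻¹ • ((x - c) + (x - p)) := by
      rw [midpoint_eq_smul_add, invOf_eq_inv]; module
    have e2 := parallelogram_law_with_norm ℝ (x - c) (x - p)
    have e3 : x - c - (x - p) = p - c := by abel
    rw [e3] at e2
    have h1 := hc x hx
    have h2 := pow_le_pow_left₀ (norm_nonneg _) (hdist x hx p hp) 2
    rw [e1, norm_smul, mul_pow]
    norm_num
    nlinarith
  have := csInf_le hSb hmid
  linarith

theorem integral_sq_le_integral_gaussian_of_convex {d : ℕ} {K : Set (EuclideanSpace ℝ (Fin d))}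
    (hKm : MeasurableSet K) (hKconv : Convex ℝ K) {μ : Measure (EuclideanSpace ℝ (Fin d))}
    [IsFiniteMeasure μ] {c B : ℝ} {x₀ : EuclideanSpace ℝ (Fin d)}
    (hμ : μ = (volume.restrict K).withDensity
      fun x => ENNReal.ofReal (Real.exp (-(c / 2 * ‖x - x₀‖ ^ 2))))
    {v w : EuclideanSpace ℝ (Fin d) → ℝ} (hv : Measurable v) (hw : Measurable w)
    (hvB : ∀ x, |v x| ≤ B) (hwB : ∀ x, |w x| ≤ B) (hv0 : ∫ x, v x ∂μ = 0)
    (H : ∀ᶠ ε in nhdsWithin (0 : ℝ) (Set.Ioi 0), ∀ x ∈ K, ∀ y ∈ K,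
      ε * (v x - v y) ≤ c / 4 * ‖x - y‖ ^ 2 + ε ^ 2 * w x) :
    ∫ x, v x ^ 2 ∂μ ≤ ∫ x, w x ∂μ := by
  refine integral_sq_le_of_integral_exp_mul_le hv hw hvB hwB hv0 ?_
  filter_upwards [H, self_mem_nhdsWithin] with ε hε (hε0 : 0 < ε)
  have hB : 0 ≤ B := (abs_nonneg _).trans (hvB 0)
  set φ : EuclideanSpace ℝ (Fin d) → ℝ := fun x => Real.exp (-(c / 2 * ‖x - x₀‖ ^ 2)) with hφ
  have hφm : Measurable φ := by fun_prop
  have conv : ∀ F : EuclideanSpace ℝ (Fin d) → ℝ, Measurable F →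
      ∫⁻ x, K.indicator (fun x => ENNReal.ofReal (φ x * Real.exp (F x))) x =
        ∫⁻ x, ENNReal.ofReal (Real.exp (F x)) ∂μ := by
    intro F hF
    rw [lintegral_indicator hKm, hμ,
      lintegral_withDensity_eq_lintegral_mul _ (by fun_prop) (by fun_prop)]
    refine lintegral_congr fun x => ?_
    rw [Pi.mul_apply, ← ENNReal.ofReal_mul (Real.exp_pos _).le]
  have hmeas : ∀ F : EuclideanSpace ℝ (Fin d) → ℝ, Measurable F →
      Measurable (K.indicator fun x => ENNReal.ofReal (φ x * Real.exp (F x))) := fun F hF =>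
    Measurable.indicator (by fun_prop) hKm
  set F₁ : EuclideanSpace ℝ (Fin d) → ℝ := fun x => ε * v x - ε ^ 2 * w x with hF₁
  set F₂ : EuclideanSpace ℝ (Fin d) → ℝ := fun x => -(ε * v x) with hF₂
  have m1 : Measurable F₁ := by fun_prop
  have m2 : Measurable F₂ := by fun_prop
  have PL := prekopaLeindler (hmeas F₁ m1) (hmeas F₂ m2) (hmeas (fun _ => 0) measurable_const) ?_
  · rw [conv _ m1, conv _ m2, conv _ measurable_const] at PL
    have expi : ∀ F : EuclideanSpace ℝ (Fin d) → ℝ, Measurable F → (∀ x, F x ≤ ε * B + ε ^ 2 * B) →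
        Integrable (fun x => Real.exp (F x)) μ := fun F hF hFB =>
      Integrable.of_bound (by fun_prop) (Real.exp (ε * B + ε ^ 2 * B)) (ae_of_all _ fun x => by
        rw [Real.norm_eq_abs, abs_of_pos (Real.exp_pos _)]
        exact Real.exp_le_exp.2 (hFB x))
    have b1 : ∀ x, F₁ x ≤ ε * B + ε ^ 2 * B := fun x => by
      have h1 := mul_le_mul_of_nonneg_left (abs_le.1 (hvB x)).2 hε0.le
      have h2 := mul_le_mul_of_nonneg_left (abs_le.1 (hwB x)).1 (sq_nonneg ε)
      simp only [hF₁]; linarith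
    have b2 : ∀ x, F₂ x ≤ ε * B + ε ^ 2 * B := fun x => by
      have h1 := mul_le_mul_of_nonneg_left (abs_le.1 (hvB x)).1 hε0.le
      have h2 := mul_nonneg (sq_nonneg ε) hB
      simp only [hF₂]; linarith
    rw [← ofReal_integral_eq_lintegral_ofReal (expi F₁ m1 b1)
        (ae_of_all _ fun x => (Real.exp_pos _).le),
      ← ofReal_integral_eq_lintegral_ofReal (expi F₂ m2 b2)
        (ae_of_all _ fun x => (Real.exp_pos _).le),
      ← ENNReal.ofReal_mul (integral_nonneg fun x => (Real.exp_pos _).le)] at PL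
    simp only [Real.exp_zero, ENNReal.ofReal_one, lintegral_const, one_mul] at PL
    rw [← ofReal_measureReal, ← ENNReal.ofReal_pow measureReal_nonneg,
      ENNReal.ofReal_le_ofReal_iff (by positivity)] at PL
    exact PL
  · intro x y
    by_cases hx : x ∈ K
    swap
    · simp [hx]
    by_cases hy : y ∈ K
    swap
    · simp [hy]
    have hz : (2 : ℝ)⁻¹ • (x + y) ∈ K := by
      rw [smul_add]
      exact hKconv hx hy (by norm_num) (by norm_num) (by norm_num)
    rw [Set.indicator_of_mem hx, Set.indicator_of_mem hy, Set.indicator_of_mem hz,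
      ← ENNReal.ofReal_mul (by positivity), ← ENNReal.ofReal_pow (by positivity)]
    refine ENNReal.ofReal_le_ofReal ?_
    simp only [hφ, ← Real.exp_add, ← Real.exp_nat_mul]
    refine Real.exp_le_exp.2 ?_
    have e1 : (2 : ℝ)⁻¹ • (x + y) - x₀ = (2 : ℝ)⁻¹ • ((x - x₀) + (y - x₀)) := by module
    have e2 := parallelogram_law_with_norm ℝ (x - x₀) (y - x₀)
    have e3 : x - x₀ - (y - x₀) = x - y := by abel
    rw [e3] at e2
    rw [e1, norm_smul, mul_pow]
    have h := hε x hx y hy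
    simp only [hF₁, hF₂]
    norm_num
    have e4 := congrArg (fun r => c * r) e2
    ring_nf at e4 h ⊢
    linarith

theorem exists_integral_sub_sq_le_of_convex {d : ℕ} {K : Set (EuclideanSpace ℝ (Fin d))}
    (hKb : Bornology.IsBounded K) (hKopen : IsOpen K) (hKconv : Convex ℝ K)
    {v : EuclideanSpace ℝ (Fin d) → ℝ} (hd : ∀ x ∈ K, DifferentiableAt ℝ v x)
    (hu : UniformContinuousOn (fderiv ℝ v) K) {B M : ℝ} (hB : ∀ x ∈ K, |v x| ≤ B)
    (hM : ∀ x ∈ K, ‖fderiv ℝ v x‖ ≤ M) {c q : ℝ} (hc : 0 < c) {x₀ : EuclideanSpace ℝ (Fin d)}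
    (hq : ∀ x ∈ K, ‖x - x₀‖ ^ 2 ≤ q) :
    ∃ m : ℝ, ∫ x in K, (v x - m) ^ 2 ≤
      1 / c * Real.exp (c / 2 * q) * ∫ x in K, ‖fderiv ℝ v x‖ ^ 2 := by
  have hKm := hKopen.measurableSet
  have hfin : IsFiniteMeasure (volume.restrict K) := ⟨by simpa using hKb.measure_lt_top⟩
  set φ : EuclideanSpace ℝ (Fin d) → ℝ := fun x => Real.exp (-(c / 2 * ‖x - x₀‖ ^ 2)) with hφ
  have hφm : Measurable φ := by fun_prop
  have hφ0 : ∀ x, 0 < φ x := fun x => Real.exp_pos _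
  have hφ1 : ∀ x, φ x ≤ 1 := fun x => Real.exp_le_one_iff.2 (by
    have : 0 ≤ c / 2 * ‖x - x₀‖ ^ 2 := by positivity
    linarith)
  set μ := (volume.restrict K).withDensity fun x => ENNReal.ofReal (φ x) with hμ
  have hμfin : IsFiniteMeasure μ := by
    refine isFiniteMeasure_withDensity (ne_top_of_le_ne_top (measure_ne_top (volume.restrict K)
      Set.univ) ?_)
    rw [← lintegral_one]
    exact lintegral_mono fun x => ENNReal.ofReal_le_one.2 (hφ1 x)
  have hac : μ ≪ volume.restrict K := withDensity_absolutelyContinuous _ _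
  have hμK : ∀ᵐ x ∂μ, x ∈ K := hac.ae_le (ae_restrict_mem hKm)
  have toμ : ∀ f : EuclideanSpace ℝ (Fin d) → ℝ, ∫ x, f x ∂μ = ∫ x in K, φ x * f x := by
    intro f
    rw [hμ, integral_withDensity_eq_integral_toReal_smul (by fun_prop) (by simp)]
    refine integral_congr_ae (ae_of_all _ fun x => ?_)
    simp [ENNReal.toReal_ofReal (hφ0 x).le]
  have ind_meas : ∀ f : EuclideanSpace ℝ (Fin d) → ℝ, ContinuousOn f K →
      Measurable (K.indicator f) := by
    intro f hf
    classical
    rw [← Set.piecewise_eq_indicator]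
    exact hf.measurable_piecewise continuousOn_const hKm
  have bdd_int : ∀ (ν : Measure (EuclideanSpace ℝ (Fin d))) [IsFiniteMeasure ν]
      (_ : ν ≪ volume.restrict K) (f : EuclideanSpace ℝ (Fin d) → ℝ) (C : ℝ), ContinuousOn f K →
      (∀ x ∈ K, |f x| ≤ C) → Integrable f ν := fun ν _ hν f C hf hC =>
    Integrable.of_bound ((hf.aestronglyMeasurable hKm).mono_ac hν) C
      (hν.ae_le ((ae_restrict_mem hKm).mono hC))
  have hvc : ContinuousOn v K := fun x hx => (hd x hx).continuousAt.continuousWithinAt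
  have hgc : ContinuousOn (fun x => ‖fderiv ℝ v x‖ ^ 2) K := hu.continuousOn.norm.pow 2
  have hgM : ∀ x ∈ K, |‖fderiv ℝ v x‖ ^ 2| ≤ M ^ 2 := fun x hx => by
    rw [abs_of_nonneg (by positivity)]
    exact pow_le_pow_left₀ (norm_nonneg _) (hM x hx) 2
  set m := ⨍ x, v x ∂μ with hm
  have huc : ContinuousOn (fun x => v x - m) K := hvc.sub continuousOn_const
  have huB : ∀ x ∈ K, |v x - m| ≤ |B| + |m| := fun x hx =>
    (abs_sub _ _).trans (add_le_add ((hB x hx).trans (le_abs_self B)) le_rfl)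
  have main : ∫ x, (v x - m) ^ 2 ∂μ ≤ ∫ x, ‖fderiv ℝ v x‖ ^ 2 / c ∂μ := by
    have step : ∀ δ > 0, ∫ x, (v x - m) ^ 2 ∂μ ≤
        ∫ x, ‖fderiv ℝ v x‖ ^ 2 / c ∂μ + δ * μ.real Set.univ := by
      intro δ hδ
      have hev := eventually_mul_sub_le_of_uniformContinuousOn_fderiv hKconv hd hu hB hM hc hδ
      have hwc : ContinuousOn (fun x => ‖fderiv ℝ v x‖ ^ 2 / c + δ) K :=
        (hgc.div_const c).add continuousOn_const
      have key := integral_sq_le_integral_gaussian_of_convex hKm hKconv (c := c) (x₀ := x₀)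
        (B := |B| + |m| + (M ^ 2 / c + δ)) hμ
        (v := K.indicator fun x => v x - m)
        (w := K.indicator fun x => ‖fderiv ℝ v x‖ ^ 2 / c + δ)
        (ind_meas _ huc) (ind_meas _ hwc) ?_ ?_ ?_ ?_
      · have e1 : ∫ x, (K.indicator (fun x => v x - m) x) ^ 2 ∂μ = ∫ x, (v x - m) ^ 2 ∂μ :=
          integral_congr_ae (hμK.mono fun x hx => by simp [hx])
        have e2 : ∫ x, K.indicator (fun x => ‖fderiv ℝ v x‖ ^ 2 / c + δ) x ∂μ =
            ∫ x, (‖fderiv ℝ v x‖ ^ 2 / c + δ) ∂μ :=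
          integral_congr_ae (hμK.mono fun x hx => by simp [hx])
        rw [e1, e2, integral_add ((bdd_int μ hac _ _ hgc hgM).div_const c)
          (integrable_const _), integral_const, smul_eq_mul] at key
        linarith
      · intro x
        have : 0 ≤ M ^ 2 / c + δ := by positivity
        by_cases hx : x ∈ K
        · simp only [hx, Set.indicator_of_mem]
          linarith [huB x hx]
        · simp only [hx, not_false_eq_true, Set.indicator_of_notMem, abs_zero]
          positivity
      · intro x
        have : 0 ≤ |B| + |m| := by positivity
        by_cases hx : x ∈ K
        · simp only [hx, Set.indicator_of_mem]
          rw [abs_of_nonneg (by positivity)]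
          have h1 := (le_abs_self _).trans (hgM x hx)
          have h2 : ‖fderiv ℝ v x‖ ^ 2 / c ≤ M ^ 2 / c := by gcongr
          linarith
        · simp only [hx, not_false_eq_true, Set.indicator_of_notMem, abs_zero]
          positivity
      · rw [← integral_sub_average μ v]
        exact integral_congr_ae (hμK.mono fun x hx => by simp [hx, hm])
      · filter_upwards [hev] with ε hε x hx y hy
        simpa [hx, hy] using hε x hx y hy
    refine le_of_forall_pos_le_add fun ε hε => ?_
    have hZ : 0 ≤ μ.real Set.univ := measureReal_nonneg
    refine (step (ε / (μ.real Set.univ + 1)) (by positivity)).trans ?_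
    gcongr
    rw [div_mul_eq_mul_div, div_le_iff₀ (by positivity)]
    nlinarith
  refine ⟨m, ?_⟩
  have hu2 : ContinuousOn (fun x => (v x - m) ^ 2) K := huc.pow 2
  have hu2B : ∀ x ∈ K, |(v x - m) ^ 2| ≤ (|B| + |m|) ^ 2 := fun x hx => by
    rw [abs_pow]; exact pow_le_pow_left₀ (abs_nonneg _) (huB x hx) 2
  have ac := Measure.AbsolutelyContinuous.refl (volume.restrict K)
  have φint : ∀ f : EuclideanSpace ℝ (Fin d) → ℝ, Integrable f (volume.restrict K) →
      Integrable (fun x => φ x * f x) (volume.restrict K) := fun f hf =>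
    hf.bdd_mul (c := 1) hφm.aestronglyMeasurable (ae_of_all _ fun x => by
      rw [Real.norm_eq_abs, abs_of_pos (hφ0 x)]; exact hφ1 x)
  have low : Real.exp (-(c / 2 * q)) * ∫ x in K, (v x - m) ^ 2 ≤ ∫ x, (v x - m) ^ 2 ∂μ := by
    rw [toμ, ← integral_const_mul]
    have i := bdd_int _ ac _ _ hu2 hu2B
    refine setIntegral_mono_on (i.const_mul _) (φint _ i) hKm fun x hx => ?_
    have h := hq x hx
    simp only [hφ]
    gcongr
  have upp : ∫ x, ‖fderiv ℝ v x‖ ^ 2 / c ∂μ ≤ 1 / c * ∫ x in K, ‖fderiv ℝ v x‖ ^ 2 := by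
    rw [toμ, ← integral_const_mul]
    have i := bdd_int _ ac _ _ hgc hgM
    refine setIntegral_mono_on (φint _ (i.div_const c)) (i.const_mul _) hKm fun x hx => ?_
    have : 0 ≤ ‖fderiv ℝ v x‖ ^ 2 / c := by positivity
    calc φ x * (‖fderiv ℝ v x‖ ^ 2 / c) ≤ 1 * (‖fderiv ℝ v x‖ ^ 2 / c) := by
          gcongr; exact hφ1 x
      _ = _ := by ring
  have fin := (low.trans main).trans upp
  rw [Real.exp_neg, inv_mul_le_iff₀ (Real.exp_pos _)] at fin
  linarith

theorem integral_sub_mean_sq_le {α : Type*} [MeasurableSpace α] {μ : Measure α}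
    [IsFiniteMeasure μ] {v : α → ℝ} (hv : Integrable v μ) (hv2 : Integrable (fun x => v x ^ 2) μ)
    (m : ℝ) :
    ∫ x, (v x - (∫ y, v y ∂μ) / μ.real Set.univ) ^ 2 ∂μ ≤ ∫ x, (v x - m) ^ 2 ∂μ := by
  rcases eq_or_ne μ 0 with rfl | hμ
  · simp
  have : NeZero μ := ⟨hμ⟩
  have hZ : 0 < μ.real Set.univ := measureReal_univ_pos
  have expand : ∀ a : ℝ, ∫ x, (v x - a) ^ 2 ∂μ =
      ∫ x, v x ^ 2 ∂μ - 2 * a * (∫ x, v x ∂μ) + a ^ 2 * μ.real Set.univ := by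
    intro a
    have : ∀ x, (v x - a) ^ 2 = v x ^ 2 - 2 * a * v x + a ^ 2 := fun x => by ring
    simp_rw [this]
    rw [integral_add (by fun_prop) (by fun_prop), integral_sub (by fun_prop) (by fun_prop),
      integral_const_mul, integral_const, smul_eq_mul]
    ring
  rw [expand, expand]
  set Z := μ.real Set.univ
  set I := ∫ y, v y ∂μ
  have : (m - I / Z) ^ 2 * Z = m ^ 2 * Z - 2 * m * I + 2 * (I / Z) * I - (I / Z) ^ 2 * Z := by
    field_simp; ring
  have h0 : 0 ≤ (m - I / Z) ^ 2 * Z := by positivity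
  have h1 : (I / Z) ^ 2 * Z = I / Z * I := by field_simp
  linarith

/-- Poincaré–Friedrichs inequality with mean value on a bounded convex open set:
`(∫_K |v - v̄|²)^{1/2} ≤ diam(K) · (∫_K ‖∇v‖²)^{1/2}`. -/
theorem poincare_friedrichs_mean_value
    (d : ℕ) (K : Set (EuclideanSpace ℝ (Fin d)))
    (hKne : K.Nonempty) (hKb : Bornology.IsBounded K) (hKconv : Convex ℝ K)
    (hKopen : IsOpen K)
    (v : EuclideanSpace ℝ (Fin d) → ℝ)
    (hv : ∃ U : Set (EuclideanSpace ℝ (Fin d)),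
      IsOpen U ∧ closure K ⊆ U ∧ ContDiffOn ℝ 1 v U)
    (vbar : ℝ) (hvbar : vbar = (∫ x in K, v x) / (volume K).toReal) :
    Real.sqrt (∫ x in K, |v x - vbar| ^ 2) ≤
      Metric.diam K * Real.sqrt (∫ x in K, ‖fderiv ℝ v x‖ ^ 2) := by
  obtain ⟨U, hUo, hKU, hvU⟩ := hv
  have hKm := hKopen.measurableSet
  have hfin : IsFiniteMeasure (volume.restrict K) := ⟨by simpa using hKb.measure_lt_top⟩
  have hKc : IsCompact (closure K) := hKb.isCompact_closure
  have hfc : ContinuousOn (fderiv ℝ v) (closure K) :=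
    (hvU.continuousOn_fderiv_of_isOpen hUo le_rfl).mono hKU
  have hvc : ContinuousOn v (closure K) := hvU.continuousOn.mono hKU
  have hd : ∀ x ∈ K, DifferentiableAt ℝ v x := fun x hx =>
    (hvU.differentiableOn one_ne_zero).differentiableAt
      (hUo.mem_nhds (hKU (subset_closure hx)))
  have hu : UniformContinuousOn (fderiv ℝ v) K :=
    (hKc.uniformContinuousOn_of_continuous hfc).mono subset_closure
  obtain ⟨B, hB⟩ := hKc.exists_bound_of_continuousOn hvc
  obtain ⟨M, hM⟩ := hKc.exists_bound_of_continuousOn hfc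
  have hvi : Integrable v (volume.restrict K) :=
    (hvc.integrableOn_compact hKc).mono_set subset_closure
  have hv2i : Integrable (fun x => v x ^ 2) (volume.restrict K) :=
    ((hvc.pow 2).integrableOn_compact hKc).mono_set subset_closure
  have hmean : ∀ m : ℝ, ∫ x in K, |v x - vbar| ^ 2 ≤ ∫ x in K, (v x - m) ^ 2 := by
    intro m
    have := integral_sub_mean_sq_le hvi hv2i m
    simp_rw [sq_abs]
    simpa [hvbar, Measure.real] using this
  set D := Metric.diam K with hD
  have hG : 0 ≤ ∫ x in K, ‖fderiv ℝ v x‖ ^ 2 := integral_nonneg fun x => by positivity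
  suffices h : ∫ x in K, |v x - vbar| ^ 2 ≤ D ^ 2 * ∫ x in K, ‖fderiv ℝ v x‖ ^ 2 by
    refine (Real.sqrt_le_sqrt h).trans_eq ?_
    rw [Real.sqrt_mul (sq_nonneg D), Real.sqrt_sq Metric.diam_nonneg]
  rcases (Metric.diam_nonneg (s := K)).eq_or_lt with h0 | hpos
  · obtain ⟨p, hp⟩ := hKne
    refine (hmean (v p)).trans ?_
    have : ∫ x in K, (v x - v p) ^ 2 = 0 := by
      refine setIntegral_eq_zero_of_forall_eq_zero fun x hx => ?_
      have : dist x p ≤ 0 := h0 ▸ Metric.dist_le_diam_of_mem hKb hx hp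
      rw [dist_le_zero.1 this]; ring
    rw [this]
    positivity
  · obtain ⟨x₀, hx₀⟩ := exists_norm_sub_sq_le_diam_sq hKne hKb hpos
    rw [← hD] at hx₀ hpos
    obtain ⟨m, hm⟩ := exists_integral_sub_sq_le_of_convex hKb hKopen hKconv hd hu
      (fun x hx => hB x (subset_closure hx)) (fun x hx => hM x (subset_closure hx))
      (c := 2 / (18 / 25 * D ^ 2)) (by positivity) hx₀
    refine ((hmean m).trans hm).trans ?_
    gcongr
    have e : 2 / (18 / 25 * D ^ 2) / 2 * (18 / 25 * D ^ 2) = 1 := by field_simp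
    have e' : 1 / (2 / (18 / 25 * D ^ 2)) = 9 / 25 * D ^ 2 := by field_simp; norm_num
    rw [e, e']
    nlinarith [Real.exp_one_lt_d9, sq_nonneg D]
end
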